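/- Let G = (V, E) be a transitive acyclic digraph and let M be a strong module of the undirected closure U(G) that is a series module of U(G). Then M is an ordered module of G. -/

import Mathlib

namespace PaperMD

variable {V : Type*}

/-- `M` is a module of the digraph with edge relation `E`: it is nonempty and
every outside vertex relates uniformly to all of `M`. -/
def IsModule (E : V → V → Prop) (M : Set V) : Prop :=
  M.Nonempty ∧ ∀ x ∉ M, ∀ a ∈ M, ∀ b ∈ M, (E x a ↔ E x b) ∧ (E a x ↔ E b x)

/-- Two vertex sets overlap: they intersect, but neither contains the other. -/
def Overlap (A B : Set V) : Prop :=
  (A ∩ B).Nonempty ∧ ¬A ⊆ B ∧ ¬B ⊆ A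

/-- A strong module: a module overlapping no module. -/
def IsStrongModule (E : V → V → Prop) (M : Set V) : Prop :=
  IsModule E M ∧ ∀ N : Set V, IsModule E N → ¬Overlap M N

/-- `a` and `b` are quotient-distinct in the module `M`: they are distinct members of `M`
and no strong module properly contained in `M` contains both. -/
def QuotDistinct (E : V → V → Prop) (M : Set V) (a b : V) : Prop :=
  a ∈ M ∧ b ∈ M ∧ a ≠ b ∧
    ∀ S : Set V, IsStrongModule E S → S ⊂ M → ¬(a ∈ S ∧ b ∈ S)

/-- `M` is a series module: every quotient-distinct pair is joined by edges both ways. -/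
def IsSeries (E : V → V → Prop) (M : Set V) : Prop :=
  IsModule E M ∧ ∀ a b, QuotDistinct E M a b → E a b ∧ E b a

/-- `M` is a parallel module: no edges between quotient-distinct pairs. -/
def IsParallel (E : V → V → Prop) (M : Set V) : Prop :=
  IsModule E M ∧ ∀ a b, QuotDistinct E M a b → ¬E a b ∧ ¬E b a

/-- `M` is an ordered module: quotient-distinct pairs are joined by exactly one directed edge,
and these edges are transitive on quotient-distinct triples. -/
def IsOrdered (E : V → V → Prop) (M : Set V) : Prop :=
  IsModule E M ∧
    (∀ a b, QuotDistinct E M a b → Xor' (E a b) (E b a)) ∧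
    (∀ a b c, QuotDistinct E M a b → QuotDistinct E M b c → QuotDistinct E M a c →
      E a b → E b c → E a c)

/-- Undirected closure `U(G)`: edge set `E ∪ E⁻¹`. -/
def UClos (E : V → V → Prop) : V → V → Prop := fun a b => E a b ∨ E b a

/-- Transitive closure `G*`: `a ≠ b` and a nonempty directed path from `a` to `b`. -/
def TClos (E : V → V → Prop) : V → V → Prop :=
  fun a b => a ≠ b ∧ Relation.TransGen E a b

/-- `G` is acyclic: no nonempty directed path leads from a vertex back to itself. -/
def Acyclic (E : V → V → Prop) : Prop := ∀ a, ¬Relation.TransGen E a a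

/-- `G` is transitive: `(a,b), (b,c) ∈ E` with `a ≠ c` implies `(a,c) ∈ E`. -/
def TransRel (E : V → V → Prop) : Prop := ∀ a b c, E a b → E b c → a ≠ c → E a c

/-- `G` is transitively reduced: no edge `(a,b)` admits a directed path from `a` to `b`
of length at least 2. -/
def TransReduced (E : V → V → Prop) : Prop :=
  ∀ a b, E a b → ¬∃ c, E a c ∧ Relation.TransGen E c b

/-- Undirected complement of a digraph: all pairs `(a,b)`, `a ≠ b`, adjacent in
neither direction. -/
def UComp (E : V → V → Prop) : V → V → Prop :=
  fun a b => a ≠ b ∧ ¬E a b ∧ ¬E b a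

/-- `seq(a,b)`: `(a,b) ∈ E`, `b` is the only successor of `a`, `a` the only
predecessor of `b`. -/
def SeqR (E : V → V → Prop) (a b : V) : Prop :=
  a ≠ b ∧ E a b ∧ (∀ c, E a c → c = b) ∧ (∀ c, E c b → c = a)

/-- `par(a,b)`: distinct vertices with identical predecessor and successor sets. -/
def ParR (E : V → V → Prop) (a b : V) : Prop :=
  a ≠ b ∧ ∀ c, (E c a ↔ E c b) ∧ (E a c ↔ E b c)

/-- Mutual reachability (reflexive): `a = b`, or nonempty directed paths both ways. -/
def MutReach (E : V → V → Prop) (a b : V) : Prop :=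
  a = b ∨ (Relation.TransGen E a b ∧ Relation.TransGen E b a)

/-- The forcing relation `Γ` between edges of an undirected graph `D`. -/
def Forces (D : V → V → Prop) (p q : V × V) : Prop :=
  D p.1 p.2 ∧ D q.1 q.2 ∧
    ((p.1 = q.1 ∧ p.2 ≠ q.2 ∧ ¬D p.2 q.2) ∨ (p.2 = q.2 ∧ p.1 ≠ q.1 ∧ ¬D p.1 q.1))

/-- `F` is an orientation of the undirected graph `D`: `F ⊆ D` and for each edge of `D`
exactly one direction lies in `F`. -/
def IsOrientation (D F : V → V → Prop) : Prop :=
  (∀ a b, F a b → D a b) ∧ ∀ a b, D a b → Xor' (F a b) (F b a)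

/-- A transitive orientation of the undirected graph `D`. -/
def IsTransOrientation (D F : V → V → Prop) : Prop :=
  IsOrientation D F ∧ ∀ a b c, F a b → F b c → a ≠ c → F a c

theorem Acyclic.not_edge_symm {E : V → V → Prop} (hacyc : Acyclic E) {a b : V} (hab : E a b) :
    ¬E b a :=
  fun hba => hacyc a (.tail (.single hab) hba)

theorem TransRel.trans_of_acyclic {E : V → V → Prop} (htrans : TransRel E) (hacyc : Acyclic E)
    {a b c : V} (hab : E a b) (hbc : E b c) : E a c :=
  htrans a b c hab hbc fun h => hacyc.not_edge_symm hab (h ▸ hbc)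

theorem UClos.symm {E : V → V → Prop} {a b : V} (h : UClos E a b) : UClos E b a :=
  Or.symm h

theorem IsModule.uClos {E : V → V → Prop} {M : Set V} (hM : IsModule E M) :
    IsModule (UClos E) M := by
  refine ⟨hM.1, fun x hx a ha b hb => ?_⟩
  obtain ⟨h₁, h₂⟩ := hM.2 x hx a ha b hb
  exact ⟨or_congr h₁ h₂, or_congr h₂ h₁⟩

/-- To be a module of the undirected closure, it suffices that every outside vertex is adjacent
to all members or to none. -/
theorem isModule_uClos_of_forall {E : V → V → Prop} {M : Set V} (hne : M.Nonempty)
    (h : ∀ y ∉ M, (∀ a ∈ M, UClos E y a) ∨ ∀ a ∈ M, ¬UClos E y a) : IsModule (UClos E) M := by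
  refine ⟨hne, fun y hy a ha b hb => ?_⟩
  have key : UClos E y a ↔ UClos E y b := by
    rcases h y hy with h | h
    · exact iff_of_true (h a ha) (h b hb)
    · exact iff_of_false (h a ha) (h b hb)
  exact ⟨key, ⟨fun h => (key.1 h.symm).symm, fun h => (key.2 h.symm).symm⟩⟩

/-- No outside vertex lies between two members of a strong module of the undirected closure of a
transitive acyclic digraph. Otherwise the vertices lying between members, together with the
members below one of them, form a module overlapping the given one. -/
theorem IsStrongModule.not_between {E : V → V → Prop} (htrans : TransRel E) (hacyc : Acyclic E)
    {M : Set V} (hM : IsStrongModule (UClos E) M) {x a b : V} (hx : x ∉ M) (ha : a ∈ M)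
    (hb : b ∈ M) (hax : E a x) (hxb : E x b) : False := by
  have tr {a b c : V} (h : E a b) (h' : E b c) : E a c := htrans.trans_of_acyclic hacyc h h'
  have unif {y p q : V} (hy : y ∉ M) (hp : p ∈ M) (hq : q ∈ M) (h : UClos E y p) :
      UClos E y q := (hM.1.2 y hy p hp q hq).1.1 h
  let X : Set V := {y | y ∉ M ∧ ∃ p ∈ M, ∃ q ∈ M, E p y ∧ E y q}
  let A : Set V := {m | m ∈ M ∧ E m x}
  have hxX : x ∈ X := ⟨hx, a, ha, b, hb, hax, hxb⟩
  have hN : IsModule (UClos E) (A ∪ X) := by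
    refine isModule_uClos_of_forall ⟨x, Or.inr hxX⟩ fun y hy => ?_
    have hyA : y ∉ A := fun h => hy (Or.inl h)
    have hyX : y ∉ X := fun h => hy (Or.inr h)
    by_cases hyM : y ∈ M
    · left
      have hxy : E x y := (unif hx ha hyM (Or.inr hax)).resolve_right fun h => hyA ⟨hyM, h⟩
      rintro z (⟨-, hzx⟩ | ⟨hzM, p, hp, q, hq, hpz, hzq⟩)
      · exact Or.inr (tr hzx hxy)
      · exact (unif hzM hp hyM (Or.inr hpz)).symm
    · by_cases hya : UClos E y a
      · left
        rintro z (⟨hz, -⟩ | ⟨hzM, p, hp, q, hq, hpz, hzq⟩)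
        · exact unif hyM ha hz hya
        · rcases unif hyM ha hp hya with hyp | hpy
          · exact Or.inl (tr hyp hpz)
          · rcases unif hyM ha hq hya with hyq | hqy
            · exact absurd ⟨hyM, p, hp, q, hq, hpy, hyq⟩ hyX
            · exact Or.inr (tr hzq hqy)
      · right
        rintro z (⟨hz, -⟩ | ⟨hzM, p, hp, q, hq, hpz, hzq⟩) hyz
        · exact hya (unif hyM hz ha hyz)
        · rcases hyz with hyz | hzy
          · exact hya (unif hyM hq ha (Or.inl (tr hyz hzq)))
          · exact hya (unif hyM hp ha (Or.inr (tr hpz hzy)))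
  refine hM.2 _ hN ⟨⟨a, ha, Or.inl ⟨ha, hax⟩⟩, fun hsub => ?_, fun hsub => hx (hsub (Or.inr hxX))⟩
  rcases hsub hb with ⟨-, hbx⟩ | ⟨hbM, -⟩
  · exact hacyc.not_edge_symm hxb hbx
  · exact hbM hb

/-- A strong module of the undirected closure of a transitive acyclic digraph is a strong module
of the digraph itself. -/
theorem IsStrongModule.of_uClos {E : V → V → Prop} (htrans : TransRel E) (hacyc : Acyclic E)
    {M : Set V} (hM : IsStrongModule (UClos E) M) : IsStrongModule E M := by
  have into {x a b : V} (hx : x ∉ M) (ha : a ∈ M) (hb : b ∈ M) (h : E x a) : E x b :=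
    ((hM.1.2 x hx a ha b hb).1.1 (Or.inl h)).resolve_right
      fun hbx => hM.not_between htrans hacyc hx hb ha hbx h
  have out {x a b : V} (hx : x ∉ M) (ha : a ∈ M) (hb : b ∈ M) (h : E a x) : E b x :=
    ((hM.1.2 x hx a ha b hb).1.1 (Or.inr h)).resolve_left
      fun hxb => hM.not_between htrans hacyc hx ha hb h hxb
  exact ⟨⟨hM.1.1, fun x hx a ha b hb =>
    ⟨⟨into hx ha hb, into hx hb ha⟩, ⟨out hx ha hb, out hx hb ha⟩⟩⟩,
    fun N hN => hM.2 N hN.uClos⟩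

/-- for a transitive acyclic digraph, a strong module of the undirected closure
that is series in the undirected closure is an ordered module of the digraph. -/
theorem stmt4 {V : Type*} [Fintype V] (E : V → V → Prop) (hirr : Irreflexive E)
    (htrans : TransRel E) (hacyc : Acyclic E) (M : Set V)
    (hstrong : IsStrongModule (UClos E) M) (hseries : IsSeries (UClos E) M) :
    IsOrdered E M := by
  refine ⟨(hstrong.of_uClos htrans hacyc).1, fun a b hab => ?_,
    fun a b c _ _ _ h h' => htrans.trans_of_acyclic hacyc h h'⟩
  obtain ⟨ha, hb, hne, hsep⟩ := hab
  have hU : QuotDistinct (UClos E) M a b :=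
    ⟨ha, hb, hne, fun S hS => hsep S (hS.of_uClos htrans hacyc)⟩
  rcases (hseries.2 a b hU).1 with h | h
  · exact Or.inl ⟨h, hacyc.not_edge_symm h⟩
  · exact Or.inr ⟨h, hacyc.not_edge_symm h⟩

end PaperMD
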